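/- Let p ∈ (p_c(d),1), x ∈ ℤ^d∖{0} and ε > 0. Then liminf_{n→∞} (1/(n‖x‖₁)) · ln ℙ_p( +∞ > D(0,nx) ≥ (1+ε)nμ(x) ) ≥ (1+ε)·(μ(x)/‖x‖₁)·ln( p(1−p)^{2d} ) > −∞; in particular the upper-deviation probability ℙ_p( +∞ > D(0,nx) ≥ (1+ε)nμ(x) ) decays at most exponentially fast in ‖nx‖₁, so the exponential speed ‖x‖₁ in the upper large deviation inequality is optimal. -/

import Mathlib

open MeasureTheory Filter
open scoped ENNReal

namespace ChemDist

/-- Vertices of the lattice `ℤ^d`. -/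
abbrev Vert (d : ℕ) := Fin d → ℤ

/-- Nearest-neighbour adjacency on `ℤ^d`: `‖x - y‖₁ = 1`. -/
def adj {d : ℕ} (x y : Vert d) : Prop := (∑ i, |x i - y i|) = 1

/-- The edge set `𝔼^d`, as a predicate on unordered pairs. -/
def IsEdge {d : ℕ} (e : Sym2 (Vert d)) : Prop := ∃ x y : Vert d, adj x y ∧ e = s(x, y)

/-- The type of edges of `ℤ^d`. -/
abbrev EdgeT (d : ℕ) := {e : Sym2 (Vert d) // IsEdge e}

/-- Percolation configurations: `Ω = {0,1}^{𝔼^d}`. -/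
abbrev Config (d : ℕ) := EdgeT d → Bool

/-- `P` is the product Bernoulli measure with parameter `p` over the index `ι`. -/
def IsProductBernoulli {ι : Type*} (p : ℝ) (P : Measure (ι → Bool)) : Prop :=
  IsProbabilityMeasure P ∧
    ∀ (s : Finset ι) (η : ι → Bool),
      P {ω | ∀ e ∈ s, ω e = η e} =
        ∏ e ∈ s, (if η e then ENNReal.ofReal p else ENNReal.ofReal (1 - p))

/-- The edge between adjacent `x` and `y` is open in `ω`. -/
def edgeOpen {d : ℕ} (ω : Config d) (x y : Vert d) : Prop :=
  ∃ h : adj x y, ω ⟨s(x, y), x, y, h, rfl⟩ = true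

/-- The chemical distance `D(x,y)(ω)`: minimal number of edges of an open path from `x`
to `y`, and `+∞` if there is no such path. -/
noncomputable def chemDist {d : ℕ} (ω : Config d) (x y : Vert d) : ℕ∞ :=
  sInf {n : ℕ∞ | ∃ l : List (Vert d),
    List.Chain (edgeOpen ω) x l ∧ (x :: l).getLast (by simp) = y ∧ n = l.length}

/-- Real-valued version of the chemical distance (with value `0` when infinite). -/
noncomputable def chemDistR {d : ℕ} (ω : Config d) (x y : Vert d) : ℝ :=
  ((chemDist ω x y).toNat : ℝ)

/-- `x ↔ y` : `x` and `y` are in the same open cluster. -/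
def Conn {d : ℕ} (ω : Config d) (x y : Vert d) : Prop := chemDist ω x y ≠ ⊤

/-- The open cluster of `x`. -/
def cluster {d : ℕ} (ω : Config d) (x : Vert d) : Set (Vert d) := {y | Conn ω x y}

/-- `x ↔ ∞`. -/
def InfCluster {d : ℕ} (ω : Config d) (x : Vert d) : Prop := (cluster ω x).Infinite

/-- The critical probability `p_c(d)` of Bernoulli bond percolation on `ℤ^d`. -/
noncomputable def pc (d : ℕ) : ℝ :=
  sInf {p : ℝ | p ∈ Set.Icc (0 : ℝ) 1 ∧
    ∀ P : Measure (Config d), IsProductBernoulli p P → 0 < P {ω | InfCluster ω 0}}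

/-- The `ℓ¹` norm on `ℝ^d`. -/
noncomputable def nrm1 {d : ℕ} (x : Fin d → ℝ) : ℝ := ∑ i, |x i|

/-- The Euclidean norm on `ℝ^d`. -/
noncomputable def nrm2 {d : ℕ} (x : Fin d → ℝ) : ℝ := Real.sqrt (∑ i, (x i) ^ 2)

/-- Canonical embedding `ℤ^d → ℝ^d`. -/
def toR {d : ℕ} (x : Vert d) : Fin d → ℝ := fun i => (x i : ℝ)

/-- `μ` is a norm on `ℝ^d`. -/
structure IsNorm {d : ℕ} (μ : (Fin d → ℝ) → ℝ) : Prop where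
  add_le : ∀ x y, μ (x + y) ≤ μ x + μ y
  smul : ∀ (c : ℝ) (x), μ (c • x) = |c| * μ x
  eq_zero_iff : ∀ x, μ x = 0 ↔ x = 0

/-- `μ` is the time constant (Garet–Marchand norm) of the chemical distance at parameter `p`:
it is a norm, and `ℙ_p`-a.s. on `{0 ↔ ∞}`, for every `u ∈ ℤ^d∖{0}` the set
`{k > 0 : ku ↔ ∞}` is infinite and `D(0, T_{n,u} u)/T_{n,u} → μ(u)` where `T_{·,u}` is its
increasing enumeration. -/
def TimeConstant (d : ℕ) (p : ℝ) (μ : (Fin d → ℝ) → ℝ) : Prop :=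
  IsNorm μ ∧
  ∀ P : Measure (Config d), IsProductBernoulli p P →
    ∀ᵐ ω ∂P, InfCluster ω 0 →
      ∀ u : Vert d, u ≠ 0 →
        {k : ℕ | 0 < k ∧ InfCluster ω (k • u)}.Infinite ∧
        Tendsto (fun n : ℕ =>
            chemDistR ω 0 ((Nat.nth (fun k => 0 < k ∧ InfCluster ω (k • u)) n) • u) /
              (Nat.nth (fun k => 0 < k ∧ InfCluster ω (k • u)) n))
          atTop (nhds (μ (toR u)))


/-- Extended-real logarithm on `ℝ≥0∞` (with `log 0 = -∞`), used for probabilities. -/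
noncomputable def elog (q : ℝ≥0∞) : EReal :=
  if q = 0 then ⊥ else ((Real.log q.toReal : ℝ) : EReal)


section ChemicalDistance

variable {d : ℕ} {ω : Config d}

theorem chemDist_le_of_path (L : ℕ) (f : ℕ → Vert d)
    (hf : ∀ k < L, edgeOpen ω (f k) (f (k + 1))) : chemDist ω (f 0) (f L) ≤ L := by
  suffices ∃ l : List (Vert d), List.IsChain (edgeOpen ω) (f 0 :: l) ∧
      (f 0 :: l).getLast (by simp) = f L ∧ l.length = L by
    obtain ⟨l, h1, h2, h3⟩ := this
    exact sInf_le ⟨l, h1, h2, by rw [h3]⟩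
  induction L generalizing f with
  | zero => exact ⟨[], List.isChain_singleton _, rfl, rfl⟩
  | succ L ih =>
    obtain ⟨l, h1, h2, h3⟩ := ih (fun k => f (k + 1)) fun k hk => hf (k + 1) (by omega)
    refine ⟨f 1 :: l, List.isChain_cons_cons.2 ⟨hf 0 (by omega), h1⟩, ?_, by simp [h3]⟩
    rw [List.getLast_cons (by simp)]
    exact h2

/-- If `Q n` contains every vertex reachable in `n` steps, then `D(x, y)` is at least any bound on
the first `n` for which `Q n y` holds. -/
theorem le_chemDist {x y : Vert d} (Q : ℕ → Vert d → Prop) (h0 : Q 0 x)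
    (hstep : ∀ n v w, Q n v → edgeOpen ω v w → Q (n + 1) w) (L : ℕ)
    (hL : ∀ n, Q n y → L ≤ n) : (L : ℕ∞) ≤ chemDist ω x y := by
  refine le_sInf ?_
  rintro _ ⟨l, h1, h2, rfl⟩
  suffices ∀ (l : List (Vert d)) (n : ℕ) (v : Vert d), Q n v → List.IsChain (edgeOpen ω) (v :: l) →
      (v :: l).getLast (by simp) = y → Q (n + l.length) y by
    have := hL _ (this l 0 x h0 h1 h2)
    exact_mod_cast (by simpa using this)
  intro l
  induction l with
  | nil => rintro n v hv - rfl; exact hv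
  | cons w l ih =>
    intro n v hv hc hlast
    obtain ⟨hvw, hc⟩ := List.isChain_cons_cons.1 hc
    rw [List.getLast_cons (by simp)] at hlast
    have := ih (n + 1) w (hstep n v w hv hvw) hc hlast
    rwa [List.length_cons, add_comm l.length, ← add_assoc]

theorem l1_dist_le_chemDist {x y : Vert d} (L : ℕ) (hL : (L : ℤ) = ∑ i, |x i - y i|) :
    (L : ℕ∞) ≤ chemDist ω x y := by
  refine le_chemDist (fun n v => ∑ i, |x i - v i| ≤ n) (by simp) ?_ L ?_
  · rintro n v w hv ⟨hvw, -⟩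
    calc ∑ i, |x i - w i| ≤ ∑ i, (|x i - v i| + |v i - w i|) :=
          Finset.sum_le_sum fun i _ => abs_sub_le _ _ _
      _ = ∑ i, |x i - v i| + 1 := by rw [Finset.sum_add_distrib, hvw]
      _ ≤ _ := by push_cast; linarith
  · intro n hn
    rw [← hL] at hn
    exact_mod_cast hn

/-- A self-avoiding path that is open while all other edges touching it are closed is the only
geodesic between its endpoints. -/
theorem chemDist_eq_of_isolated_path (L : ℕ) (f : ℕ → Vert d)
    (hinj : Set.InjOn f (Set.Iic L)) (hopen : ∀ k < L, edgeOpen ω (f k) (f (k + 1)))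
    (hclosed : ∀ k ≤ L, ∀ w, edgeOpen ω (f k) w → ∃ j < L, s(f k, w) = s(f j, f (j + 1))) :
    chemDist ω (f 0) (f L) = L := by
  refine le_antisymm (chemDist_le_of_path L f hopen) ?_
  refine le_chemDist (fun n v => ∃ j ≤ n, j ≤ L ∧ v = f j) ⟨0, by simp⟩ ?_ L ?_
  · rintro n _ w ⟨k, hkn, hkL, rfl⟩ hw
    obtain ⟨j, hj, he⟩ := hclosed k hkL w hw
    rcases Sym2.eq_iff.1 he with ⟨h1, h2⟩ | ⟨h1, h2⟩
    · have := hinj (Set.mem_Iic.2 hkL) (Set.mem_Iic.2 hj.le) h1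
      exact ⟨j + 1, by omega, by omega, h2⟩
    · have := hinj (Set.mem_Iic.2 hkL) (Set.mem_Iic.2 (by omega)) h1
      exact ⟨j, by omega, by omega, h2⟩
  · rintro n ⟨j, hjn, hjL, h⟩
    have := hinj (Set.mem_Iic.2 le_rfl) (Set.mem_Iic.2 hjL) h
    omega

end ChemicalDistance

section Paths

variable {d : ℕ}

/-- `f` restricted to `{0, …, L}` is a self-avoiding nearest-neighbour path from `x` to `y` whose
vertices lie in `S`. -/
structure IsPathIn (S : Set (Vert d)) (L : ℕ) (x y : Vert d) (f : ℕ → Vert d) : Prop where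
  start : f 0 = x
  finish : f L = y
  adj_succ : ∀ k < L, adj (f k) (f (k + 1))
  injOn : Set.InjOn f (Set.Iic L)
  mem : ∀ k ≤ L, f k ∈ S

theorem IsPathIn.cons {S T : Set (Vert d)} {L : ℕ} {x y z : Vert d} {f : ℕ → Vert d}
    (hf : IsPathIn S L x y f) (hzx : adj z x) (hzS : z ∉ S) (hST : S ⊆ T) (hzT : z ∈ T) :
    IsPathIn T (L + 1) z y (fun k => Nat.casesOn k z f) where
  start := rfl
  finish := hf.finish
  adj_succ k hk := by
    cases k with
    | zero => simpa [hf.start] using hzx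
    | succ k => exact hf.adj_succ k (by omega)
  injOn := by
    intro a ha b hb hab
    rw [Set.mem_Iic] at ha hb
    cases a with
    | zero =>
      cases b with
      | zero => rfl
      | succ b => exact absurd ((show z = f b from hab) ▸ hf.mem b (by omega)) hzS
    | succ a =>
      cases b with
      | zero => exact absurd ((show f a = z from hab) ▸ hf.mem a (by omega)) hzS
      | succ b => rw [hf.injOn (Set.mem_Iic.2 (by omega)) (Set.mem_Iic.2 (by omega)) hab]
  mem k hk := by
    cases k with
    | zero => exact hzT
    | succ k => exact hST (hf.mem k (by omega))

theorem sum_abs_sub_update (z w : Vert d) (i : Fin d) (a : ℤ) :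
    ∑ j, |w j - Function.update z i a j| = ∑ j, |w j - z j| + (|w i - a| - |w i - z i|) := by
  rw [← Finset.add_sum_erase _ _ (Finset.mem_univ i),
    ← Finset.add_sum_erase _ (fun j => |w j - z j|) (Finset.mem_univ i)]
  have : ∑ j ∈ Finset.univ.erase i, |w j - Function.update z i a j| =
      ∑ j ∈ Finset.univ.erase i, |w j - z j| :=
    Finset.sum_congr rfl fun j hj => by
      rw [Function.update_of_ne (Finset.ne_of_mem_erase hj)]
  rw [this, Function.update_self]
  ring

theorem adj_update (z : Vert d) (i : Fin d) {a : ℤ} (ha : |z i - a| = 1) :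
    adj z (Function.update z i a) := by
  rw [adj, sum_abs_sub_update]
  simp [ha]

theorem exists_monotone_path (N : ℕ) (z w : Vert d) (hN : ∑ i, |w i - z i| = N) :
    ∃ f, IsPathIn {v | ∀ i, v i ∈ Set.uIcc (z i) (w i)} N z w f := by
  induction N generalizing z with
  | zero =>
    have hzw : w = z := by
      funext i
      have := (Finset.sum_eq_zero_iff_of_nonneg (fun i _ => abs_nonneg (w i - z i))).1
        (by simpa using hN) i (Finset.mem_univ i)
      linarith [abs_eq_zero.1 this]
    subst hzw
    exact ⟨fun _ => w, rfl, rfl, by simp, fun a ha b hb _ => by simp_all, fun _ _ i => by simp⟩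
  | succ N ih =>
    obtain ⟨i, hi⟩ : ∃ i, w i ≠ z i := by
      by_contra! h
      simp only [h, sub_self, abs_zero, Finset.sum_const_zero] at hN
      push_cast at hN
      omega
    obtain ⟨a, ha1, ha2, hsub, hz⟩ : ∃ a : ℤ, |z i - a| = 1 ∧ |w i - a| = |w i - z i| - 1 ∧
        Set.uIcc a (w i) ⊆ Set.uIcc (z i) (w i) ∧ z i ∉ Set.uIcc a (w i) := by
      rcases lt_or_gt_of_ne hi with h | h
      · refine ⟨z i - 1, by simp, ?_, ?_, ?_⟩
        · rw [abs_of_nonpos (by omega), abs_of_neg (by omega)]; ring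
        · exact Set.uIcc_subset_uIcc_right (Set.mem_uIcc.2 (Or.inr (by omega)))
        · rw [Set.mem_uIcc]; omega
      · refine ⟨z i + 1, by simp, ?_, ?_, ?_⟩
        · rw [abs_of_nonneg (by omega), abs_of_pos (by omega)]; ring
        · exact Set.uIcc_subset_uIcc_right (Set.mem_uIcc.2 (Or.inl (by omega)))
        · rw [Set.mem_uIcc]; omega
    obtain ⟨f, hf⟩ := ih (Function.update z i a) (by
      rw [sum_abs_sub_update, hN, ha2]; push_cast; ring)
    refine ⟨_, hf.cons (adj_update z i ha1) ?_ ?_ ?_⟩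
    · intro h
      have := h i
      rw [Function.update_self] at this
      exact hz this
    · intro v hv j
      have := hv j
      by_cases hj : j = i
      · subst hj
        rw [Function.update_self] at this
        exact hsub this
      · rwa [Function.update_of_ne hj] at this
    · intro j
      exact Set.left_mem_uIcc

theorem exists_path_with_detour (hd : 2 ≤ d) (y : Vert d) (hy : y ≠ 0) (N : ℕ)
    (hN : ∑ i, |y i| = N) (m : ℕ) : ∃ f, IsPathIn Set.univ (N + 2 * m) 0 y f := by
  obtain ⟨i, hi⟩ : ∃ i, y i ≠ 0 := Function.ne_iff.1 hy
  have : Nontrivial (Fin d) := Fin.nontrivial_iff_two_le.2 hd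
  obtain ⟨j, hj⟩ := exists_ne i
  obtain ⟨t, ht, hty⟩ : ∃ t : ℤ, (t = 1 ∨ t = -1) ∧ t * y j ≤ 0 := by
    rcases le_total (y j) 0 with h | h
    · exact ⟨1, by simp, by simpa⟩
    · exact ⟨-1, by simp, by simpa⟩
  obtain ⟨σ, hσ1, hσ2, hσ3⟩ : ∃ σ : ℤ, |σ| = 1 ∧ |y i - σ| = |y i| - 1 ∧
      0 ∉ Set.uIcc σ (y i) := by
    rcases lt_or_gt_of_ne hi with h | h
    · refine ⟨-1, by simp, ?_, ?_⟩
      · rw [abs_of_nonpos (by omega), abs_of_neg (by omega)]; ring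
      · rw [Set.mem_uIcc]; omega
    · refine ⟨1, by simp, ?_, ?_⟩
      · rw [abs_of_nonneg (by omega), abs_of_pos (by omega)]
      · rw [Set.mem_uIcc]; omega
  have hN1 : 1 ≤ N := by
    have h1 : |y i| ≤ ∑ i, |y i| :=
      Finset.single_le_sum (f := fun i => |y i|) (fun _ _ => abs_nonneg _) (Finset.mem_univ i)
    have h2 := Int.one_le_abs hi
    omega
  -- `v k` is the point reached after `k` steps in the direction away from `y`
  set v : ℕ → Vert d := fun k => Function.update 0 j (k * t) with hv
  have hvi (k : ℕ) : v k i = 0 := by simp [hv, Function.update_of_ne hj.symm]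
  have hvj (k : ℕ) : v k j = k * t := by simp [hv]
  have hadj (k : ℕ) : adj (v k) (v (k + 1)) := by
    have : v (k + 1) = Function.update (v k) j ((k + 1 : ℕ) * t) := by simp [hv]
    rw [this]
    apply adj_update
    rw [hvj]
    rcases ht with rfl | rfl <;> simp
  have htt : t * t = 1 := by rcases ht with rfl | rfl <;> norm_num
  have key (k : ℕ) : k ≤ m → ∃ f, IsPathIn {q | q i = 0 → ((m - k : ℕ) : ℤ) ≤ t * q j}
      (N + m + k) (v (m - k)) y f := by
    induction k with
    | zero =>
      intro _
      obtain ⟨f, hf⟩ := exists_monotone_path (N + m - 1) (Function.update (v m) i σ) y (by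
        rw [sum_abs_sub_update, hvi, sub_zero, hσ2, hv]
        simp only
        rw [sum_abs_sub_update]
        simp only [Pi.zero_apply, sub_zero, hN]
        have : |y j - m * t| = |y j| + m := by
          rcases ht with rfl | rfl
          · rw [abs_of_nonpos (by omega), abs_of_nonpos (by omega)]; ring
          · rw [abs_of_nonneg (by omega), abs_of_nonneg (by omega)]; ring
        rw [this]
        push_cast [show 1 ≤ N + m by omega]
        ring)
      rw [show N + m + 0 = N + m - 1 + 1 by omega, Nat.sub_zero]
      refine ⟨_, hf.cons (adj_update _ _ (by rw [hvi]; simpa using hσ1)) ?_ ?_ ?_⟩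
      · intro h
        have := h i
        rw [Function.update_self, hvi] at this
        exact hσ3 this
      · intro q hq hqi
        have := hq i
        rw [Function.update_self, hqi] at this
        exact absurd this hσ3
      · intro _
        rw [hvj, mul_left_comm, htt]
        simp
    | succ k ih =>
      intro hk
      obtain ⟨f, hf⟩ := ih (by omega)
      refine ⟨_, hf.cons ?_ ?_ ?_ ?_⟩
      · have := hadj (m - (k + 1))
        rwa [show m - (k + 1) + 1 = m - k by omega] at this
      · intro h
        have := h (hvi _)
        rw [hvj, mul_left_comm, htt] at this
        omega
      · intro q hq hqi
        have := hq hqi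
        omega
      · intro _
        rw [hvj, mul_left_comm, htt]
        simp
  obtain ⟨f, hf⟩ := key m le_rfl
  have h0 : v (m - m) = 0 := by simp [hv]
  refine ⟨f, h0 ▸ hf.start, ?_, fun k hk => hf.adj_succ k (by omega), ?_, by simp⟩
  · rw [two_mul, ← add_assoc]; exact hf.finish
  · rw [two_mul, ← add_assoc]; exact hf.injOn

end Paths

section Probability

variable {d : ℕ}

theorem exists_update_of_adj {v w : Vert d} (h : adj v w) :
    ∃ (i : Fin d) (b : Bool), w = Function.update v i (v i + if b then 1 else -1) := by
  obtain ⟨i, hi⟩ : ∃ i, v i ≠ w i := by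
    by_contra! hvw
    simp [adj, hvw] at h
  have h1 := Int.one_le_abs (sub_ne_zero.2 hi)
  have h2 := Finset.add_sum_erase Finset.univ (fun j => |v j - w j|) (Finset.mem_univ i)
  rw [show ∑ j, |v j - w j| = 1 from h] at h2
  have h3 : 0 ≤ ∑ j ∈ Finset.univ.erase i, |v j - w j| :=
    Finset.sum_nonneg fun _ _ => abs_nonneg _
  have h4 := (Finset.sum_eq_zero_iff_of_nonneg
    (fun j (_ : j ∈ Finset.univ.erase i) => abs_nonneg (v j - w j))).1 (by omega)
  have h5 : ∀ c, w i = c → w = Function.update v i c := by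
    rintro c rfl
    funext j
    by_cases hj : j = i
    · subst hj; simp
    · have := abs_eq_zero.1 (h4 j (by simp [hj]))
      rw [Function.update_of_ne hj]
      omega
  rcases abs_eq (zero_le_one' ℤ) |>.1 (show |v i - w i| = 1 by omega) with h | h
  · exact ⟨i, false, h5 _ (by simp; omega)⟩
  · exact ⟨i, true, h5 _ (by simp; omega)⟩

/-- The edges with endpoint `v`. -/
noncomputable def incident (v : Vert d) : Finset (EdgeT d) :=
  open Classical in
  Finset.univ.image fun ib : Fin d × Bool =>
    ⟨s(v, Function.update v ib.1 (v ib.1 + if ib.2 then 1 else -1)), _, _,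
      adj_update v ib.1 (by split_ifs <;> simp), rfl⟩

theorem card_incident_le (v : Vert d) : (incident v).card ≤ 2 * d := by
  classical
  refine Finset.card_image_le.trans (le_of_eq ?_)
  simp [mul_comm]

theorem mem_incident {v w : Vert d} (h : adj v w) : ⟨s(v, w), v, w, h, rfl⟩ ∈ incident v := by
  classical
  obtain ⟨i, b, hw⟩ := exists_update_of_adj h
  subst hw
  exact Finset.mem_image.2 ⟨(i, b), Finset.mem_univ _, rfl⟩

theorem le_prob_chemDist_eq {p : ℝ} (hp0 : 0 ≤ p) (hp1 : p ≤ 1) {P : Measure (Config d)}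
    (hP : IsProductBernoulli p P) {S : Set (Vert d)} {L : ℕ} {x y : Vert d} {f : ℕ → Vert d}
    (hf : IsPathIn S L x y f) :
    ENNReal.ofReal (p ^ L * (1 - p) ^ (2 * d * (L + 1))) ≤ P {ω | chemDist ω x y = L} := by
  classical
  set T : Finset (EdgeT d) := (Finset.range (L + 1)).biUnion fun k => incident (f k) with hT
  set η : Config d := fun e => decide (∃ j < L, e.1 = s(f j, f (j + 1))) with hη
  have hsub : {ω : Config d | ∀ e ∈ T, ω e = η e} ⊆ {ω | chemDist ω x y = L} := by
    intro ω hω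
    have hval (k : ℕ) (hk : k ≤ L) (w : Vert d) (h : adj (f k) w) :
        ω ⟨s(f k, w), _, _, h, rfl⟩ = true ↔ ∃ j < L, s(f k, w) = s(f j, f (j + 1)) := by
      rw [hω _ (Finset.mem_biUnion.2 ⟨k, Finset.mem_range.2 (by omega), mem_incident h⟩)]
      exact decide_eq_true_iff
    have := chemDist_eq_of_isolated_path (ω := ω) L f hf.injOn
      (fun k hk => ⟨hf.adj_succ k hk, (hval k hk.le _ (hf.adj_succ k hk)).2 ⟨k, hk, rfl⟩⟩)
      (fun k hk w ⟨h, ho⟩ => (hval k hk w h).1 ho)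
    rwa [hf.start, hf.finish] at this
  refine le_trans ?_ (measure_mono hsub)
  rw [hP.2, Finset.prod_ite, Finset.prod_const, Finset.prod_const,
    ENNReal.ofReal_mul (pow_nonneg hp0 _), ENNReal.ofReal_pow hp0,
    ENNReal.ofReal_pow (sub_nonneg.2 hp1)]
  refine mul_le_mul' (pow_le_pow_right_of_le_one' (by simpa using hp1) ?_)
    (pow_le_pow_right_of_le_one' (by simpa using hp0) ?_)
  · rw [← Finset.card_image_of_injective _ Subtype.val_injective]
    calc _ ≤ ((Finset.range L).image fun j => s(f j, f (j + 1))).card := by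
          refine Finset.card_le_card ?_
          intro _ h_image
          obtain ⟨e, he, rfl⟩ := Finset.mem_image.1 h_image
          have hηe : η e = true := (Finset.mem_filter.1 he).2
          obtain ⟨j, hj, h⟩ := of_decide_eq_true hηe
          exact Finset.mem_image.2 ⟨j, Finset.mem_range.2 hj, h.symm⟩
      _ ≤ L := Finset.card_image_le.trans (by simp)
  · calc _ ≤ T.card := Finset.card_filter_le _ _
      _ ≤ (Finset.range (L + 1)).card * (2 * d) :=
        Finset.card_biUnion_le_card_mul _ _ _ fun k _ => card_incident_le _
      _ = _ := by rw [Finset.card_range, mul_comm]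

theorem measurableSet_edgeOpen (x y : Vert d) : MeasurableSet {ω : Config d | edgeOpen ω x y} := by
  by_cases h : adj x y
  · have : {ω : Config d | edgeOpen ω x y} = (fun ω => ω ⟨s(x, y), x, y, h, rfl⟩) ⁻¹' {true} := by
      ext ω
      simp [edgeOpen, h]
    rw [this]
    exact measurable_pi_apply _ (measurableSet_singleton _)
  · have : {ω : Config d | edgeOpen ω x y} = ∅ := by
      ext ω
      simp [edgeOpen, h]
    rw [this]
    exact MeasurableSet.empty

theorem conn_iff {ω : Config d} {x y : Vert d} : Conn ω x y ↔ ∃ l : List (Vert d),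
    List.IsChain (edgeOpen ω) (x :: l) ∧ (x :: l).getLast (by simp) = y := by
  rw [Conn, chemDist, Ne, sInf_eq_top]
  push Not
  constructor
  · rintro ⟨_, ⟨l, h1, h2, -⟩, -⟩
    exact ⟨l, h1, h2⟩
  · rintro ⟨l, h1, h2⟩
    exact ⟨_, ⟨l, h1, h2, rfl⟩, ENat.natCast_ne_top _⟩

theorem measurableSet_isChain (l : List (Vert d)) (x : Vert d) :
    MeasurableSet {ω : Config d | List.IsChain (edgeOpen ω) (x :: l)} := by
  induction l generalizing x with
  | nil => simp
  | cons y l ih =>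
    simp only [List.isChain_cons_cons]
    exact (measurableSet_edgeOpen x y).inter (ih y)

theorem measurableSet_conn (x y : Vert d) : MeasurableSet {ω : Config d | Conn ω x y} := by
  simp only [conn_iff, Set.ofPred_exists]
  exact MeasurableSet.iUnion fun l => (measurableSet_isChain l x).inter (.const _)

theorem measurableSet_infCluster (x : Vert d) :
    MeasurableSet {ω : Config d | InfCluster ω x} := by
  have : {ω : Config d | InfCluster ω x} =
      ⋂ F : Finset (Vert d), ⋃ y : Vert d, {ω | Conn ω x y ∧ y ∉ F} := by
    ext ω
    simp only [Set.mem_iInter, Set.mem_iUnion, Set.mem_ofPred_eq]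
    constructor
    · exact fun h F => h.exists_notMem_finset F
    · intro h hfin
      obtain ⟨y, hy, hyF⟩ := h hfin.toFinset
      exact hyF (hfin.mem_toFinset.2 hy)
  rw [this]
  exact MeasurableSet.iInter fun F => MeasurableSet.iUnion fun y =>
    (measurableSet_conn x y).inter (.const _)

theorem InfCluster.mono {ω ω' : Config d} (h : ∀ e, ω e = true → ω' e = true) {x : Vert d}
    (hω : InfCluster ω x) : InfCluster ω' x := by
  refine Set.Infinite.mono ?_ hω
  intro y hy
  obtain ⟨l, h1, h2⟩ := conn_iff.1 hy
  exact conn_iff.2 ⟨l, h1.imp fun a b ⟨hab, ho⟩ => ⟨hab, h _ ho⟩, h2⟩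

/-- The monotone coupling: the edge `e` is open at level `p` when its uniform label is at most
`p`. -/
noncomputable def threshold {ι : Type*} (p : ℝ) (u : ι → unitInterval) : ι → Bool :=
  fun e => decide ((u e : ℝ) ≤ p)

theorem measurable_threshold {ι : Type*} (p : ℝ) :
    Measurable (threshold p : (ι → unitInterval) → ι → Bool) := by
  refine measurable_pi_lambda _ fun e => measurable_to_bool ?_
  have : (fun u : ι → unitInterval => threshold p u e) ⁻¹' {true} =
      (fun u : ι → unitInterval => (u e : ℝ)) ⁻¹' Set.Iic p := by
    ext u
    simp [threshold]
  rw [this]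
  exact (measurable_subtype_coe.comp (measurable_pi_apply e)) measurableSet_Iic

theorem isProductBernoulli_threshold {ι : Type*} {p : ℝ} (hp : p ∈ Set.Icc (0 : ℝ) 1) :
    IsProductBernoulli p ((Measure.infinitePi fun _ : ι => (volume : Measure unitInterval)).map
      (threshold p)) := by
  refine ⟨Measure.isProbabilityMeasure_map (measurable_threshold p).aemeasurable, fun s η => ?_⟩
  have hmeas : MeasurableSet {ω : ι → Bool | ∀ e ∈ s, ω e = η e} := by
    have : {ω : ι → Bool | ∀ e ∈ s, ω e = η e} = Set.pi s fun e => {η e} := by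
      ext ω
      simp
    rw [this]
    exact .pi s.countable_toSet fun _ _ => measurableSet_singleton _
  have hIic : MeasurableSet {u : unitInterval | (u : ℝ) ≤ p} :=
    measurable_subtype_coe measurableSet_Iic
  have hvol : (volume : Measure unitInterval) {u | (u : ℝ) ≤ p} = ENNReal.ofReal p := by
    have : {u : unitInterval | (u : ℝ) ≤ p} = Set.Iic ⟨p, hp⟩ := rfl
    rw [this, unitInterval.volume_Iic]
  have hval (b : Bool) : MeasurableSet {u : unitInterval | decide ((u : ℝ) ≤ p) = b} ∧
      (volume : Measure unitInterval) {u | decide ((u : ℝ) ≤ p) = b} =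
        if b then ENNReal.ofReal p else ENNReal.ofReal (1 - p) := by
    cases b
    · have : {u : unitInterval | decide ((u : ℝ) ≤ p) = false} =
          {u : unitInterval | (u : ℝ) ≤ p}ᶜ := by
        ext u
        simp
      rw [this, prob_compl_eq_one_sub hIic, hvol, ENNReal.ofReal_sub _ hp.1]
      exact ⟨hIic.compl, by simp⟩
    · simpa only [decide_eq_true_eq, if_true] using ⟨hIic, hvol⟩
  rw [Measure.map_apply (measurable_threshold p) hmeas]
  have : threshold p ⁻¹' {ω : ι → Bool | ∀ e ∈ s, ω e = η e} =
      Set.pi s fun e => {u : unitInterval | decide ((u : ℝ) ≤ p) = η e} := by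
    ext u
    simp [threshold]
  rw [this, Measure.infinitePi_pi _ fun e _ => (hval (η e)).1]
  exact Finset.prod_congr rfl fun e _ => (hval (η e)).2

theorem percolates_at_one (hd : d ≠ 0) {P : Measure (Config d)} (hP : IsProductBernoulli 1 P) :
    0 < P {ω | InfCluster ω 0} := by
  have := hP.1
  have : NeZero d := ⟨hd⟩
  have hae : ∀ᵐ ω ∂P, ∀ e, ω e = true := by
    refine ae_all_iff.2 fun e => ?_
    have h1 := hP.2 {e} fun _ => true
    simp only [Finset.mem_singleton, forall_eq, Finset.prod_singleton, if_true,
      ENNReal.ofReal_one] at h1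
    have hmeas : MeasurableSet {ω : Config d | ω e = true} :=
      measurableSet_eq_fun (measurable_pi_apply e) measurable_const
    exact (prob_compl_eq_zero_iff hmeas).2 h1
  have hall : ∀ᵐ ω ∂P, InfCluster ω 0 := by
    filter_upwards [hae] with ω hω
    suffices cluster ω 0 = Set.univ by
      rw [InfCluster, this]
      exact Set.infinite_univ
    refine Set.eq_univ_of_forall fun y => ?_
    obtain ⟨f, hf⟩ := exists_monotone_path (∑ i, |y i - (0 : Vert d) i|).toNat 0 y
      (Int.toNat_of_nonneg (Finset.sum_nonneg fun _ _ => abs_nonneg _)).symm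
    have := chemDist_le_of_path (ω := ω) _ f fun k hk => ⟨hf.adj_succ k hk, hω _⟩
    rw [hf.start, hf.finish] at this
    exact ne_top_of_le_ne_top (ENat.natCast_ne_top _) this
  have h1 : P {ω | InfCluster ω 0} = 1 :=
    (prob_compl_eq_zero_iff (measurableSet_infCluster 0)).1 hall
  rw [h1]
  exact one_pos

theorem pc_nonneg : 0 ≤ pc d := Real.sInf_nonneg fun _ hq => hq.1.1

theorem exists_isProductBernoulli_of_pc_lt (hd : d ≠ 0) {p : ℝ} (hp : pc d < p) (hp1 : p ≤ 1) :
    ∃ P : Measure (Config d), IsProductBernoulli p P ∧ 0 < P {ω | InfCluster ω 0} := by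
  have hne : {q : ℝ | q ∈ Set.Icc (0 : ℝ) 1 ∧
      ∀ P : Measure (Config d), IsProductBernoulli q P → 0 < P {ω | InfCluster ω 0}}.Nonempty :=
    ⟨1, Set.right_mem_Icc.2 zero_le_one, fun _ => percolates_at_one hd⟩
  obtain ⟨q, ⟨hq, hqP⟩, hqp⟩ := exists_lt_of_csInf_lt
    hne hp
  refine ⟨_, isProductBernoulli_threshold ⟨pc_nonneg.trans hp.le, hp1⟩, ?_⟩
  refine (hqP _ (isProductBernoulli_threshold hq)).trans_le ?_
  rw [Measure.map_apply (measurable_threshold _) (measurableSet_infCluster 0),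
    Measure.map_apply (measurable_threshold _) (measurableSet_infCluster 0)]
  refine measure_mono fun u hu => InfCluster.mono (fun e he => ?_) hu
  simp only [threshold, decide_eq_true_eq] at he ⊢
  exact he.trans hqp.le

end Probability

section TimeConstant

variable {d : ℕ}

theorem IsNorm.pos {μ : (Fin d → ℝ) → ℝ} (h : IsNorm μ) {x : Fin d → ℝ} (hx : x ≠ 0) :
    0 < μ x := by
  have h1 := h.add_le x ((-1 : ℝ) • x)
  rw [h.smul] at h1
  simp only [neg_smul, one_smul, add_neg_cancel, (h.eq_zero_iff 0).2 rfl, abs_neg, abs_one,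
    one_mul] at h1
  exact lt_of_le_of_ne (by linarith) fun h0 => hx ((h.eq_zero_iff x).1 h0.symm)

theorem toR_ne_zero {x : Vert d} (hx : x ≠ 0) : toR x ≠ 0 := by
  intro h
  refine hx (funext fun i => ?_)
  have := congrFun h i
  simpa [toR] using this

theorem nrm1_toR (x : Vert d) : nrm1 (toR x) = ((∑ i, |x i| : ℤ) : ℝ) := by
  simp [nrm1, toR]

theorem nrm1_toR_pos {x : Vert d} (hx : x ≠ 0) : 0 < nrm1 (toR x) := by
  obtain ⟨i, hi⟩ := Function.ne_iff.1 (toR_ne_zero hx)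
  exact Finset.sum_pos' (fun _ _ => abs_nonneg _) ⟨i, Finset.mem_univ i, abs_pos.2 hi⟩

theorem sum_abs_nsmul (x : Vert d) (n : ℕ) : ∑ i, |(n • x) i| = n * ∑ i, |x i| := by
  simp [Finset.mul_sum, abs_mul]

theorem nrm1_le_of_timeConstant (hd : d ≠ 0) {p : ℝ} (hp : pc d < p) (hp1 : p ≤ 1)
    {μ : (Fin d → ℝ) → ℝ} (hμ : TimeConstant d p μ) {x : Vert d} (hx : x ≠ 0) :
    nrm1 (toR x) ≤ μ (toR x) := by
  obtain ⟨P, hP, hpos⟩ := exists_isProductBernoulli_of_pc_lt hd hp hp1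
  obtain ⟨ω, hω, hlim⟩ := ((frequently_ae_iff.2 hpos.ne').and_eventually (hμ.2 P hP)).exists
  have hlim := (hlim hω x hx).2
  refine ge_of_tendsto hlim ?_
  filter_upwards [hlim.eventually (lt_mem_nhds (hμ.1.pos (toR_ne_zero hx)))] with n hn
  set k := Nat.nth (fun k => 0 < k ∧ InfCluster ω (k • x)) n
  have hk : (0 : ℝ) < k := by
    rcases (Nat.cast_nonneg (α := ℝ) k).eq_or_lt with h | h
    · rw [← h, div_zero] at hn
      exact absurd hn (lt_irrefl _)
    · exact h
  have hfin : chemDist ω 0 (k • x) ≠ ⊤ := by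
    intro h
    rw [chemDistR, h] at hn
    simp at hn
  have hle := l1_dist_le_chemDist (ω := ω) (x := 0) (y := k • x) (k * (∑ i, |x i|).toNat) (by
    rw [Nat.cast_mul, Int.toNat_of_nonneg (Finset.sum_nonneg fun _ _ => abs_nonneg _),
      ← sum_abs_nsmul]
    simp)
  rw [le_div_iff₀ hk, nrm1_toR, chemDistR]
  rw [← ENat.natCast_toNat hfin, Nat.cast_le] at hle
  have hle' : ((k * (∑ i, |x i|).toNat : ℕ) : ℝ) ≤ (chemDist ω 0 (k • x)).toNat := by
    exact_mod_cast hle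
  have hcast : (((∑ i, |x i|).toNat : ℕ) : ℝ) = ((∑ i, |x i| : ℤ) : ℝ) := by
    exact_mod_cast congrArg (Int.cast : ℤ → ℝ)
      (Int.toNat_of_nonneg (Finset.sum_nonneg fun i (_ : i ∈ Finset.univ) => abs_nonneg (x i)))
  rw [Nat.cast_mul, hcast] at hle'
  linarith

theorem log_le_elog {r : ℝ} (hr : 0 < r) {q : ℝ≥0∞} (hq : q ≠ ⊤) (h : ENNReal.ofReal r ≤ q) :
    ((Real.log r : ℝ) : EReal) ≤ elog q := by
  have hq0 : q ≠ 0 := ((ENNReal.ofReal_pos.2 hr).trans_le h).ne'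
  rw [elog, if_neg hq0, EReal.coe_le_coe_iff]
  exact Real.log_le_log hr ((ENNReal.ofReal_le_iff_le_toReal hq).1 h)

end TimeConstant

/-- **Optimality of the speed for upper deviations**:
`liminf (1/(n‖x‖₁)) ln ℙ_p(+∞ > D(0,nx) ≥ (1+ε)nμ(x)) ≥`
`(1+ε)(μ(x)/‖x‖₁) ln(p(1-p)^{2d}) > -∞`. -/
theorem upper_deviation_liminf (d : ℕ) (hd : 2 ≤ d) (p : ℝ)
    (hp : pc d < p) (hp1 : p < 1) (μ : (Fin d → ℝ) → ℝ) (hμ : TimeConstant d p μ)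
    (P : Measure (Config d)) (hP : IsProductBernoulli p P)
    (x : Vert d) (hx : x ≠ 0) (ε : ℝ) (hε : 0 < ε) :
    (((1 + ε) * (μ (toR x) / nrm1 (toR x)) *
        Real.log (p * (1 - p) ^ (2 * d)) : ℝ) : EReal) ≤
      Filter.liminf (fun n : ℕ =>
        elog (P {ω | Conn ω 0 (n • x) ∧
            (1 + ε) * n * μ (toR x) ≤ chemDistR ω 0 (n • x)}) *
          ((((n : ℝ) * nrm1 (toR x))⁻¹ : ℝ) : EReal)) atTop := by
  have hp0 : 0 < p := pc_nonneg.trans_lt hp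
  have hq0 : 0 < 1 - p := by linarith
  have := hP.1
  have hK := nrm1_toR_pos hx
  have hKμ := nrm1_le_of_timeConstant (by omega) hp hp1.le hμ hx
  set K := nrm1 (toR x) with hKdef
  set A := (1 + ε) * μ (toR x) with hA
  have hKA : K ≤ A := by rw [hA]; nlinarith
  set ℓ := Real.log (p * (1 - p) ^ (2 * d)) with hℓ
  have hℓ_eq : ℓ = Real.log p + 2 * d * Real.log (1 - p) := by
    rw [hℓ, Real.log_mul hp0.ne' (pow_pos hq0 _).ne', Real.log_pow]
    push_cast
    ring
  have hlogp : Real.log p ≤ 0 := Real.log_nonpos hp0.le hp1.le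
  have hlogq : 2 * d * Real.log (1 - p) ≤ 0 :=
    mul_nonpos_of_nonneg_of_nonpos (by positivity) (Real.log_nonpos hq0.le (by linarith))
  have hlim : Tendsto (fun n : ℕ => (A * n + 3) * ℓ * ((n : ℝ) * K)⁻¹) atTop
      (nhds ((1 + ε) * (μ (toR x) / K) * ℓ)) := by
    have h1 : Tendsto (fun n : ℕ => A * ℓ / K + 3 * ℓ / K * (n : ℝ)⁻¹) atTop
        (nhds (A * ℓ / K + 3 * ℓ / K * 0)) :=
      tendsto_const_nhds.add (tendsto_const_nhds.mul tendsto_inv_atTop_nhds_zero_nat)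
    rw [show (1 + ε) * (μ (toR x) / K) * ℓ = A * ℓ / K + 3 * ℓ / K * 0 by rw [hA]; ring]
    refine h1.congr' ?_
    filter_upwards [eventually_gt_atTop 0] with n hn
    field_simp
  rw [← ((continuous_coe_real_ereal.tendsto _).comp hlim).liminf_eq]
  refine liminf_le_liminf ?_
  filter_upwards [eventually_gt_atTop 0] with n hn
  have hn' : (0 : ℝ) < n := Nat.cast_pos.2 hn
  set N := n * (∑ i, |x i|).toNat with hN
  have hNK : (N : ℝ) = n * K := by
    rw [hN, Nat.cast_mul, hKdef, nrm1_toR]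
    congr 1
    exact_mod_cast congrArg (Int.cast : ℤ → ℝ)
      (Int.toNat_of_nonneg (Finset.sum_nonneg fun i (_ : i ∈ Finset.univ) => abs_nonneg (x i)))
  set m := ⌈(A * n - N) / 2⌉₊ with hm
  have hm1 : (A * n - N) / 2 ≤ m := Nat.le_ceil _
  have hm2 : m < (A * n - N) / 2 + 1 := Nat.ceil_lt_add_one (by rw [hNK]; nlinarith)
  obtain ⟨f, hf⟩ := exists_path_with_detour hd (n • x) (smul_ne_zero hn.ne' hx) N (by
    rw [sum_abs_nsmul, hN, Nat.cast_mul,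
      Int.toNat_of_nonneg (Finset.sum_nonneg fun _ _ => abs_nonneg _)]) m
  set L := N + 2 * m with hL
  have hL1 : A * n ≤ L := by rw [hL]; push_cast; linarith
  have hL2 : L ≤ A * n + 2 := by rw [hL]; push_cast; linarith
  have hprob := (le_prob_chemDist_eq hp0.le hp1.le hP hf).trans
    (measure_mono (t := {ω | Conn ω 0 (n • x) ∧
      (1 + ε) * n * μ (toR x) ≤ chemDistR ω 0 (n • x)}) fun ω hω => by
        have hω : chemDist ω 0 (n • x) = L := hω
        refine ⟨?_, ?_⟩
        · rw [Conn, hω]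
          exact ENat.natCast_ne_top L
        · rw [chemDistR, hω, ENat.toNat_natCast]
          linarith)
  have hlog := log_le_elog (by positivity) (measure_ne_top P _) hprob
  rw [Real.log_mul (by positivity) (by positivity), Real.log_pow, Real.log_pow] at hlog
  have hreal : (A * n + 3) * ℓ ≤
      L * Real.log p + ((2 * d * (L + 1) : ℕ) : ℝ) * Real.log (1 - p) := by
    rw [hℓ_eq]
    push_cast
    nlinarith
  rw [Function.comp_apply, EReal.coe_mul]
  refine mul_le_mul_of_nonneg_right ((EReal.coe_le_coe_iff.2 hreal).trans hlog) ?_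
  rw [EReal.coe_nonneg]
  positivity

end ChemDist
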